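/- Let F ⊆ Sym²(ℝⁿ) be a convex cone subequation with polar cone F₊, and let W be the support of F, namely the intersection of all linear subspaces W' ⊆ ℝⁿ with F₊ ⊆ Sym²(W'). Then (Structure Theorem): F₊ ⊆ Sym²(W), so that F = F_W ⊕ Sym²(W)^⊥ (a matrix A belongs to F if and only if P_W A P_W ∈ F_W); and the restricted subequation F_W ⊆ Sym²(W) is complete in W, i.e., there is no proper subspace W'' ⊊ W such that the polar cone of F_W in Sym²(W) is contained in Sym²(W''). -/

import Mathlib

open Matrix Set Pointwise

noncomputable section

/-- `Sym²(ℝⁿ)`: the space of real symmetric `n × n` matrices,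
realized as the self-adjoint elements of the matrix algebra. -/
abbrev SymMat (n : ℕ) : Type := ↥(selfAdjoint (Matrix (Fin n) (Fin n) ℝ))

namespace SymMat

variable {n : ℕ}

/-- The trace inner product `⟨A, B⟩ = tr (A * B)` on `Sym²(ℝⁿ)`. -/
def tinner (A B : SymMat n) : ℝ :=
  ((A : Matrix (Fin n) (Fin n) ℝ) * (B : Matrix (Fin n) (Fin n) ℝ)).trace

/-- `𝒫`: the closed convex cone of positive semidefinite matrices. -/
def Psd (n : ℕ) : Set (SymMat n) :=
  {A | (A : Matrix (Fin n) (Fin n) ℝ).PosSemidef}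

/-- The set of positive definite matrices (= `Int 𝒫`). -/
def Pd (n : ℕ) : Set (SymMat n) :=
  {A | (A : Matrix (Fin n) (Fin n) ℝ).PosDef}

/-- A convex cone subequation: a closed convex cone `F ⊆ Sym²(ℝⁿ)` which is a nonempty
proper subset and satisfies the positivity condition `F + 𝒫 = F`. -/
structure IsSubequation (F : Set (SymMat n)) : Prop where
  nonempty : F.Nonempty
  proper : F ≠ Set.univ
  isClosed : IsClosed F
  convex : Convex ℝ F
  cone : ∀ t : ℝ, 0 ≤ t → ∀ A ∈ F, t • A ∈ F
  positivity : ∀ A ∈ F, ∀ P ∈ Psd n, A + P ∈ F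

/-- The polar cone `F₊ = {B : ⟨A,B⟩ ≥ 0 ∀ A ∈ F}`. -/
def polarCone (F : Set (SymMat n)) : Set (SymMat n) :=
  {B | ∀ A ∈ F, 0 ≤ tinner A B}

/-- The edge `E = F ∩ (−F)`. -/
def edge (F : Set (SymMat n)) : Set (SymMat n) := F ∩ (-F)

/-- Orthogonal complement (as a set) with respect to the trace inner product. -/
def orthSet (E : Set (SymMat n)) : Set (SymMat n) :=
  {B | ∀ A ∈ E, tinner A B = 0}

/-- `P_e = e eᵀ`, orthogonal projection onto the line spanned by `e`, as a symmetric matrix. -/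
def lineProj (e : EuclideanSpace ℝ (Fin n)) : SymMat n :=
  ⟨Matrix.vecMulVec (WithLp.equiv 2 (Fin n → ℝ) e) (WithLp.equiv 2 (Fin n → ℝ) e), by
    refine selfAdjoint.mem_iff.mpr ?_
    ext i j
    simp [Matrix.conjTranspose_apply, Matrix.vecMulVec_apply, mul_comm]⟩

/-- The matrix `P_W` of the orthogonal projection onto a subspace `W ⊆ ℝⁿ`. -/
def projMat (W : Submodule ℝ (EuclideanSpace ℝ (Fin n))) : Matrix (Fin n) (Fin n) ℝ :=
  Matrix.toEuclideanLin.symm ((W.subtypeL.comp (Submodule.orthogonalProjectionOnto W)).toLinearMap)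

/-- `Sym²(W) = {A : A = P_W A P_W}`. -/
def symOn (W : Submodule ℝ (EuclideanSpace ℝ (Fin n))) : Set (SymMat n) :=
  {A | (A : Matrix (Fin n) (Fin n) ℝ) = projMat W * A * projMat W}

/-- The restriction `F_W = {P_W A P_W : A ∈ F}` of `F` to `W` (inside `Sym²(W)`). -/
def restrictTo (F : Set (SymMat n)) (W : Submodule ℝ (EuclideanSpace ℝ (Fin n))) :
    Set (SymMat n) :=
  {B | ∃ A ∈ F, (B : Matrix (Fin n) (Fin n) ℝ) = projMat W * A * projMat W}

/-- `F` is extremely degenerate: the polar cone only involves the variables of some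
proper subspace `W ⊊ ℝⁿ`. -/
def IsExtremelyDegenerate (F : Set (SymMat n)) : Prop :=
  ∃ W : Submodule ℝ (EuclideanSpace ℝ (Fin n)), W ≠ ⊤ ∧ polarCone F ⊆ symOn W

/-- `F` is (dimensionally) complete. -/
def IsComplete (F : Set (SymMat n)) : Prop := ¬ IsExtremelyDegenerate F

/-- The interior of `F` relative to `S`. -/
def relInt (S F : Set (SymMat n)) : Set (SymMat n) :=
  {B | B ∈ S ∧ ∃ U : Set (SymMat n), IsOpen U ∧ B ∈ U ∧ U ∩ S ⊆ F}

/-- The support of `F`: the intersection of all subspaces `W'` with `F₊ ⊆ Sym²(W')`. -/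
def support (F : Set (SymMat n)) : Submodule ℝ (EuclideanSpace ℝ (Fin n)) :=
  sInf {W | polarCone F ⊆ symOn W}

/-- The polar cone of `G` taken within `Sym²(W)`. -/
def polarIn (G : Set (SymMat n)) (W : Submodule ℝ (EuclideanSpace ℝ (Fin n))) :
    Set (SymMat n) :=
  {B | B ∈ symOn W ∧ ∀ A ∈ G, 0 ≤ tinner A B}

end SymMat

namespace SymMat

variable {n : ℕ}

theorem toLin_projMat (W : Submodule ℝ (EuclideanSpace ℝ (Fin n)))
    (x : EuclideanSpace ℝ (Fin n)) :
    Matrix.toEuclideanLin (projMat W) x = (Submodule.orthogonalProjectionOnto W x : _) := by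
  simp [projMat]

theorem toLin_mul (A B : Matrix (Fin n) (Fin n) ℝ) (x : EuclideanSpace ℝ (Fin n)) :
    Matrix.toEuclideanLin (A * B) x = Matrix.toEuclideanLin A (Matrix.toEuclideanLin B x) := by
  simp [Matrix.toLpLin_apply, Matrix.mulVec_mulVec]

theorem projMat_transpose (W : Submodule ℝ (EuclideanSpace ℝ (Fin n))) :
    (projMat W)ᵀ = projMat W := by
  have h : (projMat W).IsHermitian := by
    rw [Matrix.isHermitian_iff_isSymmetric]
    intro x y
    rw [toLin_projMat, toLin_projMat]
    exact Submodule.inner_starProjection_left_eq_right W x y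
  simpa [Matrix.IsHermitian, Matrix.conjTranspose_eq_transpose_of_trivial] using h

theorem coe_transpose (A : SymMat n) :
    (A : Matrix (Fin n) (Fin n) ℝ)ᵀ = A := by
  have := A.2
  rw [selfAdjoint.mem_iff, Matrix.star_eq_conjTranspose,
    Matrix.conjTranspose_eq_transpose_of_trivial] at this
  exact this

theorem mem_symOn_iff (W : Submodule ℝ (EuclideanSpace ℝ (Fin n))) (A : SymMat n) :
    A ∈ symOn W ↔ ∀ x, Matrix.toEuclideanLin (A : Matrix (Fin n) (Fin n) ℝ) x ∈ W := by
  constructor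
  · intro h x
    have h' : (A : Matrix (Fin n) (Fin n) ℝ) = projMat W * A * projMat W := h
    rw [h', Matrix.mul_assoc, toLin_mul, toLin_projMat]
    exact Submodule.coe_mem _
  · intro h
    have h1 : projMat W * (A : Matrix (Fin n) (Fin n) ℝ) = A := by
      apply Matrix.toEuclideanLin.injective
      ext1 x
      rw [toLin_mul, toLin_projMat]
      exact Submodule.starProjection_eq_self_iff.2 (h x)
    have h2 := congrArg Matrix.transpose h1
    rw [Matrix.transpose_mul, coe_transpose, projMat_transpose] at h2
    show (A : Matrix (Fin n) (Fin n) ℝ) = projMat W * A * projMat W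
    rw [h1, h2]

theorem polar_subset_support (F : Set (SymMat n)) : polarCone F ⊆ symOn (support F) := by
  intro B hB
  rw [mem_symOn_iff]
  intro x
  rw [support, Submodule.mem_sInf]
  intro W hW
  exact (mem_symOn_iff W B).1 (hW hB) x

/-- `tr (PAP C) = tr (A C)` for `C` in `Sym²(W)`. -/
theorem trace_proj (W : Submodule ℝ (EuclideanSpace ℝ (Fin n)))
    (A : Matrix (Fin n) (Fin n) ℝ) (C : SymMat n) (hC : C ∈ symOn W) :
    ((projMat W * A * projMat W) * (C : Matrix (Fin n) (Fin n) ℝ)).trace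
      = (A * (C : Matrix (Fin n) (Fin n) ℝ)).trace := by
  have h' : (C : Matrix (Fin n) (Fin n) ℝ) = projMat W * C * projMat W := hC
  conv_rhs => rw [h']
  rw [Matrix.mul_assoc, Matrix.mul_assoc, Matrix.trace_mul_comm]
  simp only [Matrix.mul_assoc]

/-- The bipolar theorem. -/
theorem bipolar (F : Set (SymMat n)) (hF : IsSubequation F) (A : SymMat n)
    (hA : ∀ C ∈ polarCone F, 0 ≤ tinner A C) : A ∈ F := by
  by_contra hAF
  let emb : SymMat n →ₗ[ℝ] (Fin n → Fin n → ℝ) :=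
    { toFun := fun B => (B : Matrix (Fin n) (Fin n) ℝ)
      map_add' := fun _ _ => rfl
      map_smul' := fun _ _ => rfl }
  have hembc : Topology.IsClosedEmbedding emb := by
    have h : IsClosed {M : Matrix (Fin n) (Fin n) ℝ | star M = M} :=
      isClosed_eq (by fun_prop) continuous_id
    exact IsClosed.isClosedEmbedding_subtypeVal h
  have hcl : IsClosed (emb '' F) := hembc.isClosedMap _ hF.isClosed
  have hconv : Convex ℝ (emb '' F) := hF.convex.linear_image emb
  have hnot : emb A ∉ emb '' F := by
    rintro ⟨B, hB, hBA⟩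
    exact hAF (hembc.injective hBA ▸ hB)
  obtain ⟨f, u, hfA, hfF⟩ := geometric_hahn_banach_point_closed hconv hcl hnot
  have h0 : (0 : SymMat n) ∈ F := by
    obtain ⟨B, hB⟩ := hF.nonempty
    simpa using hF.cone 0 le_rfl B hB
  have hu : u < 0 := by
    have := hfF _ ⟨0, h0, rfl⟩
    simpa using this
  have hpos : ∀ B ∈ F, 0 ≤ f (emb B) := by
    intro B hB
    by_contra! hneg
    have := hfF _ ⟨_, hF.cone (u / f (emb B)) (div_nonneg_of_nonpos hu.le hneg.le) B hB, rfl⟩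
    rw [map_smul, map_smul, smul_eq_mul, div_mul_cancel₀ _ hneg.ne] at this
    exact lt_irrefl _ this
  let N : Matrix (Fin n) (Fin n) ℝ := fun i j => f (Pi.single j (Pi.single i 1))
  have hN : ∀ M : Matrix (Fin n) (Fin n) ℝ, (M * N).trace = f M := by
    intro M
    have hM : (show Fin n → Fin n → ℝ from M) =
        ∑ i, ∑ j, M i j • (Pi.single i (Pi.single j (1 : ℝ)) : Fin n → Fin n → ℝ) := by
      ext a b
      simp [Finset.sum_apply, Pi.single_apply, ite_apply]
    have hf : f M = f (∑ i, ∑ j, M i j • (Pi.single i (Pi.single j (1 : ℝ)) : Fin n → Fin n → ℝ)) :=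
      congrArg f hM
    rw [hf]
    simp only [Matrix.trace, Matrix.diag_apply, Matrix.mul_apply, map_sum, map_smul, smul_eq_mul]
    rfl
  have hs : N + Nᵀ ∈ selfAdjoint (Matrix (Fin n) (Fin n) ℝ) := by
    rw [selfAdjoint.mem_iff, Matrix.star_eq_conjTranspose,
      Matrix.conjTranspose_eq_transpose_of_trivial, Matrix.transpose_add,
      Matrix.transpose_transpose, add_comm]
  have hC : ∀ B : SymMat n, tinner B ⟨N + Nᵀ, hs⟩ = 2 * f (emb B) := by
    intro B
    have h1 : ((B : Matrix (Fin n) (Fin n) ℝ) * N).trace = f (emb B) := hN _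
    have h2 : ((B : Matrix (Fin n) (Fin n) ℝ) * Nᵀ).trace = f (emb B) := by
      rw [← h1, ← Matrix.trace_transpose, Matrix.transpose_mul, Matrix.transpose_transpose,
        coe_transpose, Matrix.trace_mul_comm]
    unfold tinner
    simp only [Matrix.mul_add, Matrix.trace_add, h1, h2]
    ring
  have hmem : (⟨N + Nᵀ, hs⟩ : SymMat n) ∈ polarCone F := by
    intro B hB
    rw [hC]
    have := hpos B hB
    positivity
  have := hA _ hmem
  rw [hC] at this
  linarith

end SymMat

open SymMat in
theorem structure_theorem {n : ℕ} (F : Set (SymMat n)) (hF : IsSubequation F) :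
    polarCone F ⊆ symOn (support F) ∧
    (∀ A : SymMat n, A ∈ F ↔ ∃ B ∈ restrictTo F (support F),
        (B : Matrix (Fin n) (Fin n) ℝ) = projMat (support F) * A * projMat (support F)) ∧
    ¬ ∃ W'' : Submodule ℝ (EuclideanSpace ℝ (Fin n)), W'' < support F ∧
        polarIn (restrictTo F (support F)) (support F) ⊆ symOn W'' := by
  refine ⟨polar_subset_support F, fun A => ⟨fun hA => ?_, ?_⟩, ?_⟩
  · have hs : projMat (support F) * (A : Matrix (Fin n) (Fin n) ℝ) * projMat (support F)
        ∈ selfAdjoint (Matrix (Fin n) (Fin n) ℝ) := by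
      rw [selfAdjoint.mem_iff, Matrix.star_eq_conjTranspose,
        Matrix.conjTranspose_eq_transpose_of_trivial, Matrix.transpose_mul, Matrix.transpose_mul,
        coe_transpose, projMat_transpose, Matrix.mul_assoc]
    exact ⟨⟨_, hs⟩, ⟨A, hA, rfl⟩, rfl⟩
  · rintro ⟨B, ⟨A', hA', hB⟩, hB'⟩
    apply bipolar F hF
    intro C hC
    have hCW := polar_subset_support F hC
    have := hC A' hA'
    unfold tinner at this ⊢
    rw [← trace_proj _ _ C hCW] at this ⊢
    rwa [← hB', hB]
  · rintro ⟨W, hW, hsub⟩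
    have : polarCone F ⊆ symOn W := by
      intro C hC
      have hCW := polar_subset_support F hC
      apply hsub
      refine ⟨hCW, ?_⟩
      rintro B ⟨A, hA, hB⟩
      have := hC A hA
      unfold tinner at this ⊢
      rwa [hB, trace_proj _ _ C hCW]
    exact absurd (show support F ≤ W from sInf_le this) (not_le_of_gt hW)
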